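/- There exists an absolute constant C > 0 such that the following holds. Let q be a prime power, let A be a multiplicative subgroup of F_q^* with |A| ≥ q^{2/3}, and let σ : F_q → ℝ be defined by σ(x) = q/|A| if x ∈ A and σ(x) = 0 otherwise. Then for all functions f, g : F_q → [−1, 1], |q^{−2} Σ_{x,y ∈ F_q} f(x)·g(y)·σ(x−y)|² ≤ q^{−2} Σ_{x,y ∈ F_q} f(x)·f(y) + C·q^{1/2}/|A|. -/

import Mathlib

section FourierFiniteField

variable {F : Type*} [Field F] [Fintype F]

/-- The unnormalized Fourier transform of a real function on a finite field, with respect to a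
fixed additive character. -/
noncomputable def charTransform (ψ : AddChar F ℂ) (h : F → ℝ) (ξ : F) : ℂ :=
  ∑ x, (h x : ℂ) * ψ (ξ * x)

theorem charTransform_zero (ψ : AddChar F ℂ) (h : F → ℝ) :
    charTransform ψ h 0 = ((∑ x, h x : ℝ) : ℂ) := by
  simp [charTransform]

theorem sum_norm_sq_charTransform {ψ : AddChar F ℂ} (hψ : ψ.IsPrimitive) (h : F → ℝ) :
    ∑ ξ, ‖charTransform ψ h ξ‖ ^ 2 = Fintype.card F * ∑ x, h x ^ 2 := by
  classical
  have key : ∑ ξ, charTransform ψ h ξ * (starRingEnd ℂ) (charTransform ψ h ξ) =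
      (Fintype.card F : ℂ) * ∑ x, (h x : ℂ) ^ 2 := by
    have expand (ξ : F) : charTransform ψ h ξ * (starRingEnd ℂ) (charTransform ψ h ξ) =
        ∑ x, ∑ y, (h x : ℂ) * h y * ψ (ξ * (x - y)) := by
      rw [charTransform, map_sum, Finset.sum_mul_sum]
      refine Finset.sum_congr rfl fun x _ => Finset.sum_congr rfl fun y _ => ?_
      rw [map_mul (starRingEnd ℂ), Complex.conj_ofReal, ← AddChar.map_neg_eq_conj, mul_sub, sub_eq_add_neg,
        AddChar.map_add_eq_mul]
      ring
    simp_rw [expand]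
    rw [Finset.sum_comm, Finset.mul_sum]
    refine Finset.sum_congr rfl fun x _ => ?_
    rw [Finset.sum_comm]
    simp_rw [← Finset.mul_sum, AddChar.sum_mulShift _ hψ, sub_eq_zero]
    simp
    ring
  simp_rw [Complex.mul_conj, Complex.normSq_eq_norm_sq] at key
  exact_mod_cast key

theorem charTransform_correlation (ψ : AddChar F ℂ) (f σ : F → ℝ) (ξ : F) :
    charTransform ψ (fun y => ∑ x, f x * σ (x - y)) ξ =
      charTransform ψ f ξ * charTransform ψ σ (-ξ) := by
  simp only [charTransform, Complex.ofReal_sum, Complex.ofReal_mul, Finset.sum_mul]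
  rw [Finset.sum_comm]
  refine Finset.sum_congr rfl fun x _ => ?_
  rw [← (Equiv.subLeft x).sum_comp, Finset.mul_sum]
  refine Finset.sum_congr rfl fun z _ => ?_
  rw [Equiv.subLeft_apply, sub_sub_cancel, mul_sub, sub_eq_add_neg, AddChar.map_add_eq_mul,
    neg_mul]
  ring

theorem card_mul_norm_sq_charTransform_le {ψ : AddChar F ℂ} (hψ : ψ.IsPrimitive)
    (A : Subgroup Fˣ) {σ : F → ℝ} (hσ : ∀ u ∈ A, ∀ x, σ (u * x) = σ x) {ξ : F} (hξ : ξ ≠ 0) :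
    Nat.card A * ‖charTransform ψ σ ξ‖ ^ 2 ≤ Fintype.card F * ∑ x, σ x ^ 2 := by
  classical
  have inv (u : A) : charTransform ψ σ (ξ * ((u : Fˣ) : F)) = charTransform ψ σ ξ := by
    refine Fintype.sum_equiv (Units.mulLeft (u : Fˣ)) _ _ fun x => ?_
    rw [Units.mulLeft_apply, hσ _ u.2, mul_assoc]
  have inj : Function.Injective fun u : A => ξ * ((u : Fˣ) : F) := fun u v huv =>
    Subtype.ext (Units.ext (mul_left_cancel₀ hξ huv))
  rw [← sum_norm_sq_charTransform hψ]
  refine le_trans (le_of_eq ?_) (Finset.sum_le_univ_sum_of_nonneg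
    (s := Finset.univ.map ⟨fun u : A => ξ * ((u : Fˣ) : F), inj⟩) fun η => by positivity)
  rw [Finset.sum_map]
  simp only [Function.Embedding.coeFn_mk, inv, Finset.sum_const, Finset.card_univ, nsmul_eq_mul,
    Nat.card_eq_fintype_card]

theorem card_mul_sum_correlation_sq_le {ψ : AddChar F ℂ} (hψ : ψ.IsPrimitive) (f σ : F → ℝ)
    {M : ℝ} (hM : ∀ ξ ≠ 0, ‖charTransform ψ σ ξ‖ ^ 2 ≤ M) (hM₀ : 0 ≤ M) :
    Fintype.card F * ∑ y, (∑ x, f x * σ (x - y)) ^ 2 ≤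
      (∑ x, f x) ^ 2 * (∑ x, σ x) ^ 2 + M * (Fintype.card F * ∑ x, f x ^ 2) := by
  classical
  rw [← sum_norm_sq_charTransform hψ, ← sum_norm_sq_charTransform hψ,
    ← Finset.add_sum_erase _ _ (Finset.mem_univ (0 : F))]
  simp_rw [charTransform_correlation, norm_mul, mul_pow]
  refine add_le_add (le_of_eq ?_) ?_
  · rw [neg_zero, charTransform_zero, charTransform_zero, Complex.norm_real, Complex.norm_real,
      Real.norm_eq_abs, Real.norm_eq_abs, sq_abs, sq_abs]
  · rw [Finset.mul_sum]
    refine (Finset.sum_le_sum fun ξ hξ => ?_).trans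
      (Finset.sum_le_univ_sum_of_nonneg fun ξ => by positivity)
    rw [mul_comm]
    gcongr
    exact hM _ (neg_ne_zero.2 (Finset.ne_of_mem_erase hξ))

theorem AddChar.exists_isPrimitive_complex (F : Type*) [Field F] [Finite F] :
    ∃ ψ : AddChar F ℂ, ψ.IsPrimitive := by
  obtain ⟨ψ, hψ⟩ := AddChar.exists_apply_ne_zero.2 (one_ne_zero (α := F))
  exact ⟨ψ, .of_ne_one fun h => hψ (by simp [h])⟩

theorem sum_eq_card_mul_of_indicator (A : Subgroup Fˣ) {φ : F → ℝ} {c : ℝ}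
    (h₁ : ∀ x : F, (∃ u ∈ A, (u : F) = x) → φ x = c)
    (h₀ : ∀ x : F, (¬∃ u ∈ A, (u : F) = x) → φ x = 0) :
    ∑ x, φ x = Nat.card A * c := by
  classical
  rw [← Fintype.sum_of_injective (fun u : A => ((u : Fˣ) : F))
    (fun u v huv => Subtype.ext (Units.ext huv)) (fun _ => c) φ
    (fun x hx => h₀ x fun ⟨u, hu, hux⟩ => hx ⟨⟨u, hu⟩, hux⟩)
    (fun u => (h₁ _ ⟨u, u.2, rfl⟩).symm)]
  simp

theorem indicator_apply_unit_mul (A : Subgroup Fˣ) {φ : F → ℝ} {c : ℝ}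
    (h₁ : ∀ x : F, (∃ u ∈ A, (u : F) = x) → φ x = c)
    (h₀ : ∀ x : F, (¬∃ u ∈ A, (u : F) = x) → φ x = 0) (u : Fˣ) (hu : u ∈ A) (x : F) :
    φ (u * x) = φ x := by
  by_cases hx : ∃ v ∈ A, (v : F) = x
  · obtain ⟨v, hv, rfl⟩ := hx
    rw [h₁ _ ⟨u * v, A.mul_mem hu hv, by simp⟩, h₁ _ ⟨v, hv, rfl⟩]
  · rw [h₀ x hx, h₀]
    rintro ⟨v, hv, hvx⟩
    exact hx ⟨u⁻¹ * v, A.mul_mem (A.inv_mem hu) hv, by simp [hvx]⟩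

end FourierFiniteField


theorem stmt_11 :
    ∃ C : ℝ, 0 < C ∧
      ∀ (F : Type) [Field F] [Fintype F],
        ∀ A : Subgroup Fˣ,
          (Fintype.card F : ℝ) ^ ((2 : ℝ) / 3) ≤ (Nat.card A : ℝ) →
          ∀ σ : F → ℝ,
            (∀ x : F, (∃ u ∈ A, (u : F) = x) →
              σ x = (Fintype.card F : ℝ) / (Nat.card A : ℝ)) →
            (∀ x : F, (¬∃ u ∈ A, (u : F) = x) → σ x = 0) →
            ∀ f g : F → ℝ,
              (∀ x, f x ∈ Set.Icc (-1 : ℝ) 1) →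
              (∀ x, g x ∈ Set.Icc (-1 : ℝ) 1) →
              |(∑ x : F, ∑ y : F, f x * g y * σ (x - y)) / (Fintype.card F : ℝ) ^ 2| ^ 2 ≤
                (∑ x : F, ∑ y : F, f x * f y) / (Fintype.card F : ℝ) ^ 2 +
                  C * (Fintype.card F : ℝ) ^ ((1 : ℝ) / 2) / (Nat.card A : ℝ) := by
  refine ⟨1, one_pos, fun F _ _ A hA σ h₁ h₀ f g hf hg => ?_⟩
  obtain ⟨ψ, hψ⟩ := AddChar.exists_isPrimitive_complex F
  have hq1 : (1 : ℝ) ≤ Fintype.card F := by exact_mod_cast Fintype.card_pos (α := F)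
  have ha0 : (0 : ℝ) < Nat.card A := by exact_mod_cast Nat.card_pos (α := A)
  have hs : (Fintype.card F : ℝ) ^ ((1 : ℝ) / 2) ≤ Nat.card A :=
    (Real.rpow_le_rpow_of_exponent_le hq1 (by norm_num)).trans hA
  have hss : (Fintype.card F : ℝ) ^ ((1 : ℝ) / 2) * (Fintype.card F : ℝ) ^ ((1 : ℝ) / 2) =
      Fintype.card F := by
    rw [← Real.rpow_add (by linarith)]
    norm_num
  have hs0 : (0 : ℝ) < (Fintype.card F : ℝ) ^ ((1 : ℝ) / 2) := by positivity
  have hsum := sum_eq_card_mul_of_indicator A h₁ h₀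
  have hsq := sum_eq_card_mul_of_indicator A (φ := fun x => σ x ^ 2) (fun x hx => by rw [h₁ x hx])
    (fun x hx => by rw [h₀ x hx, zero_pow two_ne_zero])
  have hf2 : ∑ x, f x ^ 2 ≤ Fintype.card F := by
    simpa using Finset.sum_le_sum fun x (_ : x ∈ Finset.univ) =>
      (sq_le_one_iff_abs_le_one _).2 (abs_le.2 (hf x))
  have hg2 : ∑ x, g x ^ 2 ≤ Fintype.card F := by
    simpa using Finset.sum_le_sum fun x (_ : x ∈ Finset.univ) =>
      (sq_le_one_iff_abs_le_one _).2 (abs_le.2 (hg x))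
  have hM (ξ : F) (hξ : ξ ≠ 0) :
      ‖charTransform ψ σ ξ‖ ^ 2 ≤ (Fintype.card F : ℝ) ^ 3 / (Nat.card A : ℝ) ^ 2 := by
    have h := card_mul_norm_sq_charTransform_le hψ A (indicator_apply_unit_mul A h₁ h₀) hξ
    rw [hsq] at h
    refine le_of_mul_le_mul_left (h.trans_eq ?_) ha0
    field_simp
  have hcorr := card_mul_sum_correlation_sq_le hψ f σ hM (by positivity)
  have hcs := Finset.sum_mul_sq_le_sq_mul_sq Finset.univ g fun y => ∑ x, f x * σ (x - y)
  have hS : ∑ x, ∑ y, f x * g y * σ (x - y) = ∑ y, g y * ∑ x, f x * σ (x - y) := by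
    rw [Finset.sum_comm]
    refine Finset.sum_congr rfl fun y _ => ?_
    rw [Finset.mul_sum]
    exact Finset.sum_congr rfl fun x _ => by ring
  rw [hS, ← Finset.sum_mul_sum, sq_abs, div_pow]
  rw [hsum, mul_div_cancel₀ _ ha0.ne'] at hcorr
  generalize (Fintype.card F : ℝ) ^ ((1 : ℝ) / 2) = s at *
  generalize (Fintype.card F : ℝ) = q at *
  generalize (Nat.card A : ℝ) = a at *
  have hq0 : 0 < q := by linarith
  have hbound : (∑ y, g y * ∑ x, f x * σ (x - y)) ^ 2 ≤
      (∑ x, f x) ^ 2 * q ^ 2 + q ^ 3 / a ^ 2 * (q * q) := by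
    refine hcs.trans ((mul_le_mul_of_nonneg_right hg2 (by positivity)).trans (hcorr.trans ?_))
    gcongr
  calc _ ≤ ((∑ x, f x) ^ 2 * q ^ 2 + q ^ 3 / a ^ 2 * (q * q)) / (q ^ 2) ^ 2 := by gcongr
    _ = (∑ x, f x) * (∑ x, f x) / q ^ 2 + s * s / a ^ 2 := by
      rw [hss]
      field_simp
    _ ≤ (∑ x, f x) * (∑ x, f x) / q ^ 2 + s * a / a ^ 2 := by gcongr
    _ = _ := by field_simp
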